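/- The set U := {(a, b) ∈ O × O | η(conj a) * a + η(conj b) + b = 0}, equipped with the operation (a,b) + (c,d) := (a+c, b+d − η(conj c) * a), is a group: U is closed under the operation, the operation is associative, (0,0) is a two-sided identity, and the two-sided inverse of (a,b) ∈ U is (−a, −b − η(conj a) * a), which again lies in U. (This is the group structure of the root group derived in Section 5.1 of the paper.) -/

import Mathlib

noncomputable section

open Quaternion

/-- Multiplication of the Cayley–Dickson double `O = D × D` of the quaternion algebra `D`. -/
def omul {k : Type*} [Field k] {c₁ c₂ : k} (β : k)
    (x y : ℍ[k,c₁,c₂] × ℍ[k,c₁,c₂]) : ℍ[k,c₁,c₂] × ℍ[k,c₁,c₂] :=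
  (x.1 * y.1 - β • (y.2 * star x.2), y.1 * x.2 + star x.1 * y.2)

/-- Conjugation of the Cayley–Dickson double. -/
def oconj {k : Type*} [Field k] {c₁ c₂ : k}
    (x : ℍ[k,c₁,c₂] × ℍ[k,c₁,c₂]) : ℍ[k,c₁,c₂] × ℍ[k,c₁,c₂] :=
  (star x.1, -x.2)

/-- The root group `U` attached to the involutive automorphism `η`. -/
def Uset {k : Type*} [Field k] {c₁ c₂ : k} (β : k)
    (η : ℍ[k,c₁,c₂] × ℍ[k,c₁,c₂] → ℍ[k,c₁,c₂] × ℍ[k,c₁,c₂]) :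
    Set ((ℍ[k,c₁,c₂] × ℍ[k,c₁,c₂]) × (ℍ[k,c₁,c₂] × ℍ[k,c₁,c₂])) :=
  {u | omul β (η (oconj u.1)) u.1 + η (oconj u.2) + u.2 = 0}

/-- The group operation on `U`. -/
def Uadd {k : Type*} [Field k] {c₁ c₂ : k} (β : k)
    (η : ℍ[k,c₁,c₂] × ℍ[k,c₁,c₂] → ℍ[k,c₁,c₂] × ℍ[k,c₁,c₂])
    (u v : (ℍ[k,c₁,c₂] × ℍ[k,c₁,c₂]) × (ℍ[k,c₁,c₂] × ℍ[k,c₁,c₂])) :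
    (ℍ[k,c₁,c₂] × ℍ[k,c₁,c₂]) × (ℍ[k,c₁,c₂] × ℍ[k,c₁,c₂]) :=
  (u.1 + v.1, u.2 + v.2 - omul β (η (oconj v.1)) u.1)

section helpers
variable {k : Type*} [Field k] {c₁ c₂ : k} (β : k)

theorem aux_add_left (x y z : ℍ[k,c₁,c₂] × ℍ[k,c₁,c₂]) :
    omul β (x + y) z = omul β x z + omul β y z := by
  simp only [omul, Prod.fst_add, Prod.snd_add, star_add, mul_add, add_mul, smul_add, Prod.mk_add_mk]
  ext1 <;> dsimp only <;> abel

theorem aux_add_right (x y z : ℍ[k,c₁,c₂] × ℍ[k,c₁,c₂]) :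
    omul β x (y + z) = omul β x y + omul β x z := by
  simp only [omul, Prod.fst_add, Prod.snd_add, mul_add, add_mul, smul_add, Prod.mk_add_mk]
  ext1 <;> dsimp only <;> abel

theorem aux_conj_add (x y : ℍ[k,c₁,c₂] × ℍ[k,c₁,c₂]) :
    oconj (x + y) = oconj x + oconj y := by
  simp only [oconj, Prod.fst_add, Prod.snd_add, star_add, neg_add, Prod.mk_add_mk]

theorem aux_conj_conj (x : ℍ[k,c₁,c₂] × ℍ[k,c₁,c₂]) : oconj (oconj x) = x := by
  simp only [oconj, star_star, neg_neg]

theorem aux_star_smul (r : k) (x : ℍ[k,c₁,c₂]) : star (r • x) = r • star x := by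
  ext <;> simp

theorem aux_conj_mul (x y : ℍ[k,c₁,c₂] × ℍ[k,c₁,c₂]) :
    oconj (omul β x y) = omul β (oconj y) (oconj x) := by
  simp only [oconj, omul, star_sub, star_mul, star_star, aux_star_smul, star_neg, neg_mul, mul_neg,
    neg_neg]
  ext1
  · rfl
  · dsimp only
    abel

end helpers

/-- `U` with the operation `(a,b)+(c,d) = (a+c, b+d-η(conj c)·a)` is a group. -/
theorem Uset_is_group {k : Type*} [Field k] (c₁ c₂ : k) (β : k) (hβ : β ≠ 0)
    (η : ℍ[k,c₁,c₂] × ℍ[k,c₁,c₂] → ℍ[k,c₁,c₂] × ℍ[k,c₁,c₂])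
    (hbij : Function.Bijective η)
    (hadd : ∀ x y, η (x + y) = η x + η y)
    (hmul : ∀ x y, η (omul β x y) = omul β (η x) (η y))
    (hone : η ((1 : ℍ[k,c₁,c₂]), (0 : ℍ[k,c₁,c₂])) = (1, 0))
    (hinvol : ∀ x, η (η x) = x)
    (hconj : ∀ x, η (oconj x) = oconj (η x)) :
    (∀ u ∈ Uset β η, ∀ v ∈ Uset β η, Uadd β η u v ∈ Uset β η) ∧
    (∀ u ∈ Uset β η, ∀ v ∈ Uset β η, ∀ w ∈ Uset β η,
      Uadd β η (Uadd β η u v) w = Uadd β η u (Uadd β η v w)) ∧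
    ((0, 0) ∈ Uset β η) ∧
    (∀ u ∈ Uset β η, Uadd β η u (0, 0) = u ∧ Uadd β η (0, 0) u = u) ∧
    (∀ u ∈ Uset β η,
      (-u.1, -u.2 - omul β (η (oconj u.1)) u.1) ∈ Uset β η ∧
      Uadd β η u (-u.1, -u.2 - omul β (η (oconj u.1)) u.1) = (0, 0) ∧
      Uadd β η (-u.1, -u.2 - omul β (η (oconj u.1)) u.1) u = (0, 0)) := by
  let L : ∀ z, (ℍ[k,c₁,c₂] × ℍ[k,c₁,c₂]) →+ (ℍ[k,c₁,c₂] × ℍ[k,c₁,c₂]) :=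
    fun z => AddMonoidHom.mk' (fun x => omul β x z) (fun x y => aux_add_left β x y z)
  let R : ∀ z, (ℍ[k,c₁,c₂] × ℍ[k,c₁,c₂]) →+ (ℍ[k,c₁,c₂] × ℍ[k,c₁,c₂]) :=
    fun z => AddMonoidHom.mk' (fun x => omul β z x) (fun x y => aux_add_right β z x y)
  let T : (ℍ[k,c₁,c₂] × ℍ[k,c₁,c₂]) →+ (ℍ[k,c₁,c₂] × ℍ[k,c₁,c₂]) :=
    AddMonoidHom.mk' (fun x => η (oconj x)) (fun x y => by rw [aux_conj_add, hadd])
  have l0 : ∀ z, omul β 0 z = 0 := fun z => (L z).map_zero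
  have ln : ∀ x z, omul β (-x) z = -omul β x z := fun x z => (L z).map_neg x
  have r0 : ∀ z, omul β z 0 = 0 := fun z => (R z).map_zero
  have rn : ∀ x z, omul β z (-x) = -omul β z x := fun x z => (R z).map_neg x
  have t0 : η (oconj 0) = 0 := T.map_zero
  have ta : ∀ x y, η (oconj (x + y)) = η (oconj x) + η (oconj y) := T.map_add
  have tn : ∀ x, η (oconj (-x)) = -η (oconj x) := T.map_neg
  have ts : ∀ x y, η (oconj (x - y)) = η (oconj x) - η (oconj y) := T.map_sub
  have tm : ∀ x y, η (oconj (omul β (η (oconj x)) y)) = omul β (η (oconj y)) x := by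
    intro x y
    rw [aux_conj_mul, hmul, hconj (η (oconj x)), hinvol, aux_conj_conj]
  refine ⟨?_, ?_, ?_, ?_, ?_⟩
  · rintro ⟨a, b⟩ hu ⟨c, d⟩ hv
    simp only [Uset, Uadd, Set.mem_ofPred_eq] at hu hv ⊢
    rw [ts, tm, ta, ta, aux_add_left, aux_add_right, aux_add_right]
    rw [← add_zero (0 : ℍ[k,c₁,c₂] × ℍ[k,c₁,c₂])]
    nth_rewrite 1 [← hu]
    rw [← hv]
    abel
  · rintro ⟨a, b⟩ - ⟨c, d⟩ - ⟨e, f⟩ -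
    simp only [Uadd, ta, aux_add_left, aux_add_right]
    ext1 <;> dsimp only <;> abel
  · simp only [Uset, Set.mem_ofPred_eq, r0, t0, add_zero]
  · rintro ⟨a, b⟩ -
    simp only [Uadd, r0, l0, t0, add_zero, zero_add, sub_zero, and_self]
  · rintro ⟨a, b⟩ hu
    simp only [Uset, Uadd, Set.mem_ofPred_eq, ts, tn, tm, ln, rn] at hu ⊢
    refine ⟨?_, ?_, ?_⟩
    · refine Eq.trans ?_ (neg_eq_zero.mpr hu)
      abel
    · ext1 <;> dsimp only <;> abel
    · ext1 <;> dsimp only <;> abel
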